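/- arXiv:2312.03859 — 3 statements merged into one kernel-verified Lean document; each statement's English description precedes it below -/
import Mathlib

section
/- Let ℓ ≥ 1 and k ≥ 2 be integers, let A ∈ {0,1}^{h×h} be a matrix with him(A) < ℓ, and let 𝒜 ⊆ [h]^k. Then there exists a subset 𝒜' ⊆ 𝒜 that A^{⊗k}-represents 𝒜 with |𝒜'| ≤ k^{kℓ}. -/
open Filter

section Defs

variable {I J K L : Type*}

/-- The matrix `M` has an `m × m` identity submatrix after permutation
(an induced matching of size `m`). -/
def HasMim (M : I → J → Prop) (m : ℕ) : Prop :=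
  ∃ (r : Fin m → I) (c : Fin m → J), Function.Injective r ∧ Function.Injective c ∧
    ∀ i j, M (r i) (c j) ↔ i = j

/-- `mim M` is the largest `m` such that `M` has an `m × m` identity submatrix
after permutation. -/
noncomputable def mim (M : I → J → Prop) : ℕ := sSup {m | HasMim M m}

/-- The matrix `M` has a half-induced matching of size `m`. -/
def HasHim (M : I → J → Prop) (m : ℕ) : Prop :=
  ∃ (r : Fin m → I) (c : Fin m → J), Function.Injective r ∧ Function.Injective c ∧
    (∀ i, M (r i) (c i)) ∧ ∀ i j : Fin m, i < j → ¬ M (r i) (c j)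

/-- `him M` is the largest `m` such that `M` has a half-induced matching of size `m`. -/
noncomputable def him (M : I → J → Prop) : ℕ := sSup {m | HasHim M m}

/-- Kronecker product of two 0/1 (`Prop`-valued) matrices. -/
def kron (M : I → J → Prop) (N : K → L → Prop) : I × K → J × L → Prop :=
  fun p q => M p.1 q.1 ∧ N p.2 q.2

/-- `k`-fold Kronecker power of a 0/1 (`Prop`-valued) matrix. -/
def kronPow (M : I → J → Prop) (k : ℕ) : (Fin k → I) → (Fin k → J) → Prop :=
  fun r c => ∀ t, M (r t) (c t)

/-- `mimsup M = limsup_{k → ∞} mim (M^{⊗ k}) ^ (1/k)`. -/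
noncomputable def mimsup (M : I → J → Prop) : ℝ :=
  Filter.atTop.limsup fun k : ℕ => (mim (kronPow M k) : ℝ) ^ (1 / (k : ℝ))

/-- `𝒜'` is a subset of `𝒜` that `M`-represents `𝒜`. -/
def Represents (M : I → J → Prop) (𝒜 𝒜' : Set I) : Prop :=
  𝒜' ⊆ 𝒜 ∧ ∀ j, (∃ i ∈ 𝒜, M i j) → ∃ i' ∈ 𝒜', M i' j

end Defs

theorem HasHim.card_le {I J : Type*} [Fintype I] {M : I → J → Prop} {m : ℕ} (h : HasHim M m) :
    m ≤ Fintype.card I := by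
  obtain ⟨r, -, hr, -⟩ := h
  simpa using Fintype.card_le_of_injective r hr

theorem HasHim.le_him {I J : Type*} [Fintype I] {M : I → J → Prop} {m : ℕ} (h : HasHim M m) :
    m ≤ him M :=
  le_csSup ⟨Fintype.card I, fun _ hm => hm.card_le⟩ h

/-- A half-induced matching avoiding the neighbourhood of a non-isolated row `a` can be extended
by `a`. -/
theorem HasHim.succ {I J : Type*} {M : I → J → Prop} {a : I} {b : J} (hab : M a b) {m : ℕ}
    (h : HasHim (fun i j => M i j ∧ ¬ M a j) m) : HasHim M (m + 1) := by
  obtain ⟨r, c, hr, hc, hd, hu⟩ := h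
  refine ⟨Fin.cons a r, Fin.cons b c, ?_, ?_, ?_, ?_⟩
  · refine Fin.cons_injective_iff.2 ⟨?_, hr⟩
    rintro ⟨i, rfl⟩
    exact (hd i).2 (hd i).1
  · refine Fin.cons_injective_iff.2 ⟨?_, hc⟩
    rintro ⟨i, rfl⟩
    exact (hd i).2 hab
  · intro i
    cases i using Fin.cases with
    | zero => exact hab
    | succ i => exact (hd i).1
  · intro i j hij hM
    cases j using Fin.cases with
    | zero => exact absurd hij (Fin.not_lt_zero i)
    | succ j =>
      cases i using Fin.cases with
      | zero => exact (hd j).2 hM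
      | succ i => exact hu i j (Fin.succ_lt_succ_iff.1 hij) ⟨hM, (hd j).2⟩

theorem hasHim_one {I J : Type*} {M : I → J → Prop} {a : I} {b : J} (hab : M a b) :
    HasHim M 1 :=
  HasHim.succ hab ⟨Fin.elim0, Fin.elim0, fun i => i.elim0, fun i => i.elim0, fun i => i.elim0,
    fun i => i.elim0⟩

/-- Every set of rows of a Kronecker product of matrices `M t` has a representing subset whose
size is bounded in terms of the sizes `g t` of half-induced matchings of the factors. -/
theorem exists_represents_pi {ι I J : Type*} [Fintype ι] (hι : 2 ≤ Fintype.card ι)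
    (𝒜 : Set (ι → I)) (n : ℕ) (M : ι → I → J → Prop) (g : ι → ℕ)
    (hg : ∀ t m, HasHim (M t) m → m ≤ g t) (hn : ∑ t, g t ≤ n) :
    ∃ S : Finset (ι → I), Represents (fun (a : ι → I) (b : ι → J) => ∀ t, M t (a t) (b t)) 𝒜 ↑S ∧
      S.card + 1 ≤ Fintype.card ι ^ n := by
  classical
  induction n generalizing M g with
  | zero =>
    refine ⟨∅, ⟨by simp, ?_⟩, by simp⟩
    rintro b ⟨a, -, hab⟩
    obtain ⟨t⟩ : Nonempty ι := Fintype.card_pos_iff.1 (by omega)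
    have h1 := hg t 1 (hasHim_one (hab t))
    have h2 := Finset.single_le_sum (f := g) (fun _ _ => Nat.zero_le _) (Finset.mem_univ t)
    omega
  | succ n ih =>
    by_cases hne : ∃ a ∈ 𝒜, ∃ b : ι → J, ∀ t, M t (a t) (b t)
    · obtain ⟨a, ha, b, hab⟩ := hne
      have step (s : ι) := ih
        (Function.update M s fun i j => M s i j ∧ ¬ M s (a s) j)
        (Function.update g s (g s - 1))
        (by
          intro t m hm
          by_cases hts : t = s
          · subst hts
            rw [Function.update_self] at hm ⊢
            have := hg t _ (HasHim.succ (hab t) hm)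
            omega
          · rw [Function.update_of_ne hts] at hm ⊢
            exact hg t m hm)
        (by
          have h1 := hg s 1 (hasHim_one (hab s))
          rw [Finset.sum_update_of_mem (Finset.mem_univ s)]
          rw [← Finset.add_sum_erase _ _ (Finset.mem_univ s), Finset.erase_eq] at hn
          omega)
      choose S hS hcard using step
      refine ⟨insert a (Finset.univ.biUnion S), ⟨?_, ?_⟩, ?_⟩
      · intro x hx
        rcases Finset.mem_insert.1 (Finset.mem_coe.1 hx) with rfl | hx
        · exact ha
        · obtain ⟨s, -, hs⟩ := Finset.mem_biUnion.1 hx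
          exact (hS s).1 hs
      · rintro y ⟨x, hx, hxy⟩
        by_cases hay : ∀ t, M t (a t) (y t)
        · exact ⟨a, by simp, hay⟩
        · obtain ⟨s, hs⟩ := not_forall.1 hay
          obtain ⟨z, hz, hzy⟩ := (hS s).2 y ⟨x, hx, fun t => by
            by_cases hts : t = s
            · subst hts
              simpa using ⟨hxy t, hs⟩
            · simpa [Function.update_of_ne hts] using hxy t⟩
          refine ⟨z, Finset.mem_coe.2 <| Finset.mem_insert_of_mem <|
            Finset.mem_biUnion.2 ⟨s, Finset.mem_univ s, hz⟩, fun t => ?_⟩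
          have hzt := hzy t
          by_cases hts : t = s
          · subst hts
            rw [Function.update_self] at hzt
            exact hzt.1
          · rwa [Function.update_of_ne hts] at hzt
      · have h1 := Finset.card_insert_le a (Finset.univ.biUnion S)
        have h2 : (Finset.univ.biUnion S).card ≤ ∑ s, (S s).card := Finset.card_biUnion_le
        have h3 : ∑ s, ((S s).card + 1) ≤ ∑ _s : ι, Fintype.card ι ^ n :=
          Finset.sum_le_sum fun s _ => hcard s
        simp only [Finset.sum_add_distrib, Finset.sum_const, Finset.card_univ, smul_eq_mul,
          mul_one] at h3
        rw [pow_succ']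
        omega
    · refine ⟨∅, ⟨by simp, ?_⟩, by simpa using Nat.one_le_pow _ _ (by omega)⟩
      rintro b ⟨a, ha, hab⟩
      exact absurd ⟨a, ha, b, hab⟩ hne

theorem stmt3 {h : ℕ} (ℓ k : ℕ) (hℓ : 1 ≤ ℓ) (hk : 2 ≤ k)
    (A : Fin h → Fin h → Prop) (hA : him A < ℓ) (𝒜 : Set (Fin k → Fin h)) :
    ∃ 𝒜' : Set (Fin k → Fin h),
      Represents (kronPow A k) 𝒜 𝒜' ∧ 𝒜'.ncard ≤ k ^ (k * ℓ) := by
  obtain ⟨S, hS, hcard⟩ := exists_represents_pi (by simpa using hk) 𝒜 (k * ℓ) (fun _ => A)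
    (fun _ => ℓ) (fun _ _ hm => hm.le_him.trans hA.le) (by simp)
  rw [Fintype.card_fin] at hcard
  exact ⟨S, hS, by rw [Set.ncard_coe_finset]; omega⟩
end

section
/- For any 0/1 matrix A, mim(A) ≤ him(A) ≤ mimsup(A). -/
open Filter

section HalfInducedMatching

variable {I J : Type*} {M : I → J → Prop} {m : ℕ}

theorem HasMim.hasHim (h : HasMim M m) : HasHim M m := by
  obtain ⟨r, c, hr, hc, h⟩ := h
  exact ⟨r, c, hr, hc, fun i => (h i i).2 rfl, fun i j hij hM => hij.ne ((h i j).1 hM)⟩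

theorem HasHim.le_card [Fintype I] (h : HasHim M m) : m ≤ Fintype.card I := by
  obtain ⟨r, _, hr, _⟩ := h
  simpa using Fintype.card_le_of_injective r hr

theorem bddAbove_hasHim [Finite I] (M : I → J → Prop) : BddAbove {m | HasHim M m} := by
  have := Fintype.ofFinite I
  exact ⟨Fintype.card I, fun _ h => h.le_card⟩

theorem bddAbove_hasMim [Finite I] (M : I → J → Prop) : BddAbove {m | HasMim M m} :=
  (bddAbove_hasHim M).mono fun _ h => h.hasHim

theorem hasMim_zero (M : I → J → Prop) : HasMim M 0 :=
  ⟨Fin.elim0, Fin.elim0, fun i => i.elim0, fun i => i.elim0, fun i => i.elim0⟩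

theorem hasHim_him [Finite I] (M : I → J → Prop) : HasHim M (him M) :=
  Nat.sSup_mem ⟨0, (hasMim_zero M).hasHim⟩ (bddAbove_hasHim M)

theorem hasMim_mim [Finite I] (M : I → J → Prop) : HasMim M (mim M) :=
  Nat.sSup_mem ⟨0, hasMim_zero M⟩ (bddAbove_hasMim M)

theorem mim_le_him [Finite I] (M : I → J → Prop) : mim M ≤ him M :=
  le_csSup (bddAbove_hasHim M) (hasMim_mim M).hasHim

theorem mim_le_card [Fintype I] (M : I → J → Prop) : mim M ≤ Fintype.card I :=
  (hasMim_mim M).hasHim.le_card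

theorem card_le_mim [Finite I] {α : Type*} (s : Finset α) (r : α → I) (c : α → J)
    (h : ∀ a ∈ s, ∀ b ∈ s, M (r a) (c b) ↔ a = b) : s.card ≤ mim M := by
  set e : Fin s.card → α := fun i => s.equivFin.symm i
  have he : ∀ i j, M (r (e i)) (c (e j)) ↔ i = j := fun i j => by
    rw [h _ (Subtype.prop _) _ (Subtype.prop _), Subtype.coe_inj, EmbeddingLike.apply_eq_iff_eq]
  refine le_csSup (bddAbove_hasMim M) ⟨r ∘ e, c ∘ e, fun i j hij => ?_, fun i j hij => ?_, he⟩
  · exact (he i j).1 ((congrArg (M · (c (e j))) hij).mpr ((he j j).2 rfl))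
  · exact (he i j).1 ((congrArg (M (r (e i))) hij).mp ((he i i).2 rfl))

/-- Words over a half-induced matching with a fixed letter sum form an induced matching in the
Kronecker power, and there are at most `m * k` possible sums. -/
theorem HasHim.pow_le_mim_kronPow [Finite I] (h : HasHim M m) {k : ℕ} (hk : k ≠ 0) :
    m ^ k ≤ mim (kronPow M k) * (m * k) := by
  obtain ⟨r, c, -, -, hdiag, htri⟩ := h
  have key := Finset.card_le_mul_card_image_of_maps_to (s := Finset.univ)
    (t := Finset.range (m * k)) (f := fun w : Fin k → Fin m => ∑ t, (w t : ℕ))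
    (fun w _ => ?_) (mim (kronPow M k)) fun S _ => ?_
  · simpa using key
  · have : Nonempty (Fin k) := Fin.pos_iff_nonempty.1 (Nat.pos_of_ne_zero hk)
    have := Finset.sum_lt_sum_of_nonempty (Finset.univ_nonempty (α := Fin k))
      (f := fun t => (w t : ℕ)) (g := fun _ => m) fun t _ => (w t).isLt
    simpa [mul_comm] using this
  · refine card_le_mim _ (fun w t => r (w t)) (fun w t => c (w t)) fun v hv w hw => ⟨fun hM => ?_, ?_⟩
    · simp only [Finset.mem_filter, Finset.mem_univ, true_and] at hv hw
      have hle : ∀ t, w t ≤ v t := fun t => not_lt.1 fun hlt => htri _ _ hlt (hM t)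
      have heq := (Finset.sum_eq_sum_iff_of_le fun t _ => Fin.le_def.1 (hle t)).1 (hw.trans hv.symm)
      exact funext fun t => Fin.ext (heq t (Finset.mem_univ t)).symm
    · rintro rfl t
      exact hdiag _

theorem isBoundedUnder_mim_kronPow [Finite I] (M : I → J → Prop) :
    IsBoundedUnder (· ≤ ·) atTop fun k : ℕ => (mim (kronPow M k) : ℝ) ^ (1 / (k : ℝ)) := by
  have := Fintype.ofFinite I
  refine ⟨Fintype.card I, eventually_map.2 ?_⟩
  filter_upwards [eventually_ne_atTop 0] with k hk
  have h : (mim (kronPow M k) : ℝ) ≤ (Fintype.card I : ℝ) ^ k := by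
    exact_mod_cast (mim_le_card (kronPow M k)).trans_eq (by simp)
  rw [one_div]
  calc (mim (kronPow M k) : ℝ) ^ (k : ℝ)⁻¹ ≤ ((Fintype.card I : ℝ) ^ k) ^ (k : ℝ)⁻¹ := by gcongr
    _ = Fintype.card I := Real.pow_rpow_inv_natCast (by positivity) hk

theorem HasHim.le_mimsup [Finite I] (h : HasHim M m) : (m : ℝ) ≤ mimsup M := by
  have hlim : Tendsto (fun k : ℕ => (m : ℝ) / ((m : ℝ) ^ (1 / (k : ℝ)) * (k : ℝ) ^ (1 / (k : ℝ))))
      atTop (nhds m) := by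
    rcases eq_or_ne m 0 with rfl | hm
    · simp
    have hconst : Tendsto (fun k : ℕ => (m : ℝ) ^ (1 / (k : ℝ))) atTop (nhds 1) := by
      simpa [Function.comp_def] using ((Real.continuous_const_rpow
        (Nat.cast_ne_zero.2 hm : (m : ℝ) ≠ 0)).tendsto 0).comp tendsto_one_div_atTop_nhds_zero_nat
    have hroot := tendsto_rpow_div.comp (tendsto_natCast_atTop_atTop (R := ℝ))
    have hdiv := (tendsto_const_nhds (x := (m : ℝ))).div (hconst.mul hroot) (by simp)
    rwa [mul_one, div_one] at hdiv
  rw [← hlim.limsup_eq]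
  refine limsup_le_limsup ?_ hlim.isCoboundedUnder_le (isBoundedUnder_mim_kronPow M)
  filter_upwards [eventually_ne_atTop 0] with k hk
  refine div_le_of_le_mul₀ (by positivity) (by positivity) ?_
  have hpow : (m : ℝ) ^ k ≤ mim (kronPow M k) * (m * k) := by
    exact_mod_cast h.pow_le_mim_kronPow hk
  rw [← Real.mul_rpow (by positivity) (by positivity),
    ← Real.mul_rpow (by positivity) (by positivity), one_div]
  calc (m : ℝ) = ((m : ℝ) ^ k) ^ (k : ℝ)⁻¹ := (Real.pow_rpow_inv_natCast (by positivity) hk).symm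
    _ ≤ _ := by gcongr

end HalfInducedMatching

theorem stmt5 {n m : ℕ} (A : Fin n → Fin m → Prop) :
    mim A ≤ him A ∧ (him A : ℝ) ≤ mimsup A := by
  exact ⟨mim_le_him A, (hasHim_him A).le_mimsup⟩
end

section
/- For all sufficiently large integers h, there exists a symmetric 0/1 matrix A of dimensions 2h × 2h that contains no all-zero submatrix (after permutation) of dimensions 2⌈2·log₂ h⌉ × 2⌈2·log₂ h⌉, and yet mim(A^{⊗2}) ≥ h. -/
open Filter

/-- The matrix `M` has an all-zero `m × m` submatrix after permutation. -/
def HasZeroBlock {I J : Type*} (M : I → J → Prop) (m : ℕ) : Prop :=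
  ∃ (r : Fin m → I) (c : Fin m → J), Function.Injective r ∧ Function.Injective c ∧
    ∀ i j, ¬ M (r i) (c j)

lemma HasMim.le_mim {I J : Type*} [Finite I] {M : I → J → Prop} {m : ℕ} (hm : HasMim M m) :
    m ≤ mim M := by
  refine le_csSup ⟨Nat.card I, ?_⟩ hm
  rintro k ⟨r, -, hr, -⟩
  simpa using Nat.card_le_card_of_injective r hr

lemma card_filter_eqOn_mul {α : Type*} [Fintype α] [DecidableEq α] (S : Finset α) (b : Bool) :
    (Finset.univ.filter fun f : α → Bool => ∀ x ∈ S, f x = b).card * 2 ^ S.card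
      = 2 ^ Fintype.card α := by
  have key : (Finset.univ.filter fun f : α → Bool => ∀ x ∈ S, f x = b)
      = Fintype.piFinset fun x => if x ∈ S then {b} else Finset.univ := by
    ext f
    simp only [Finset.mem_filter, Finset.mem_univ, true_and, Fintype.mem_piFinset]
    refine forall_congr' fun x => ?_
    by_cases hx : x ∈ S <;> simp [hx]
  have hcard : ∀ x, (if x ∈ S then ({b} : Finset Bool) else Finset.univ).card
      = if x ∈ S then 1 else 2 := by
    intro x
    by_cases hx : x ∈ S <;> simp [hx]
  rw [key, Fintype.card_piFinset, Finset.prod_congr rfl fun x _ => hcard x]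
  have hpow : (2 : ℕ) ^ S.card = ∏ x, if x ∈ S then 2 else 1 := by
    simp [Finset.prod_ite_mem]
  rw [hpow, ← Finset.prod_mul_distrib]
  have : ∀ x, ((if x ∈ S then 1 else 2) * if x ∈ S then 2 else 1 : ℕ) = 2 := by
    intro x
    by_cases hx : x ∈ S <;> simp [hx]
  simp [this]

/-- Bipartite Ramsey lower bound: if `2 * n ^ (2 * k) < 2 ^ (k * k)`, the pairs from an
`n`-element type have a two-colouring without a monochromatic `K_{k,k}`. -/
lemma exists_colouring_no_mono_biclique {V : Type*} [Fintype V] [DecidableEq V] (k : ℕ)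
    (hk : 2 * Fintype.card V ^ (2 * k) < 2 ^ (k * k)) :
    ∃ g : Sym2 V → Bool, ∀ (b : Bool) (r c : Fin k → V), Function.Injective r →
      Function.Injective c → (∀ i j, r i ≠ c j) → ¬ ∀ i j, g s(r i, c j) = b := by
  by_contra! hcon
  let edges (r c : Fin k → V) : Finset (Sym2 V) :=
    Finset.univ.image fun p : Fin k × Fin k => s(r p.1, c p.2)
  let T : Finset (Bool × (Fin k → V) × (Fin k → V)) :=
    Finset.univ.filter fun t => (edges t.2.1 t.2.2).card = k * k
  let bad (t : Bool × (Fin k → V) × (Fin k → V)) : Finset (Sym2 V → Bool) :=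
    Finset.univ.filter fun f => ∀ x ∈ edges t.2.1 t.2.2, f x = t.1
  have hcover : (Finset.univ : Finset (Sym2 V → Bool)) ⊆ T.biUnion bad := by
    intro g _
    obtain ⟨b, r, c, hr, hc, hrc, hg⟩ := hcon g
    refine Finset.mem_biUnion.2 ⟨(b, r, c), ?_, ?_⟩
    · have hinj : Function.Injective fun p : Fin k × Fin k => s(r p.1, c p.2) := by
        rintro ⟨i, j⟩ ⟨i', j'⟩ h
        rcases Sym2.eq_iff.1 h with ⟨h₁, h₂⟩ | ⟨h₁, -⟩
        · exact Prod.ext (hr h₁) (hc h₂)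
        · exact absurd h₁ (hrc _ _)
      simp [T, edges, Finset.card_image_of_injective _ hinj]
    · simp only [bad, edges, Finset.mem_filter, Finset.mem_univ, true_and, Finset.mem_image]
      rintro _ ⟨p, rfl⟩
      exact hg _ _
  have hbad : ∀ t ∈ T, (bad t).card * 2 ^ (k * k) = 2 ^ Fintype.card (Sym2 V) := by
    intro t ht
    rw [← (Finset.mem_filter.1 ht).2]
    exact card_filter_eqOn_mul _ _
  have hT : T.card ≤ 2 * Fintype.card V ^ (2 * k) := by
    refine (Finset.card_le_univ T).trans (le_of_eq ?_)
    simp [two_mul, pow_add]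
  have hle : 2 ^ Fintype.card (Sym2 V) ≤ ∑ t ∈ T, (bad t).card := by
    simpa using (Finset.card_le_card hcover).trans Finset.card_biUnion_le
  have hsum : 2 ^ Fintype.card (Sym2 V) * 2 ^ (k * k)
      ≤ 2 ^ Fintype.card (Sym2 V) * (2 * Fintype.card V ^ (2 * k)) := by
    calc 2 ^ Fintype.card (Sym2 V) * 2 ^ (k * k)
        ≤ (∑ t ∈ T, (bad t).card) * 2 ^ (k * k) := Nat.mul_le_mul_right _ hle
      _ = T.card * 2 ^ Fintype.card (Sym2 V) := by
          rw [Finset.sum_mul, Finset.sum_congr rfl hbad, Finset.sum_const, smul_eq_mul]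
      _ ≤ _ := by
          rw [mul_comm]
          exact Nat.mul_le_mul_left _ hT
  exact absurd (Nat.le_of_mul_le_mul_left hsum (by positivity)) (not_le.2 hk)

/-- The symmetric matrix with diagonal blocks the two colour classes of `g`, both with ones on
the diagonal, and all-one off-diagonal blocks. -/
def colourMatrix {V : Type*} (g : Sym2 V → Bool) : V ⊕ V → V ⊕ V → Prop
  | .inl i, .inl j => i = j ∨ g s(i, j) = true
  | .inr i, .inr j => i = j ∨ g s(i, j) = false
  | _, _ => True

lemma colourMatrix_symm {V : Type*} (g : Sym2 V → Bool) (x y : V ⊕ V) :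
    colourMatrix g x y ↔ colourMatrix g y x := by
  rcases x with i | i <;> rcases y with j | j <;>
    simp [colourMatrix, eq_comm (a := i), Sym2.eq_swap (a := i)]

lemma not_hasZeroBlock_colourMatrix {V : Type*} (g : Sym2 V → Bool) {k : ℕ} (hk : 0 < k)
    (hg : ∀ (b : Bool) (r c : Fin k → V), Function.Injective r →
      Function.Injective c → (∀ i j, r i ≠ c j) → ¬ ∀ i j, g s(r i, c j) = b) :
    ¬ HasZeroBlock (colourMatrix g) k := by
  rintro ⟨r, c, hr, hc, h⟩
  let z : Fin k := ⟨0, hk⟩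
  have hll : ∀ i j v, r i = .inl v → ∃ w, c j = .inl w := by
    intro i j v hv
    have := h i j
    rcases hw : c j with w | w
    · exact ⟨w, rfl⟩
    · simp [hv, hw, colourMatrix] at this
  have hrr : ∀ i j v, r i = .inr v → ∃ w, c j = .inr w := by
    intro i j v hv
    have := h i j
    rcases hw : c j with w | w
    · simp [hv, hw, colourMatrix] at this
    · exact ⟨w, rfl⟩
  rcases hz : r z with v | v
  · choose c' hc' using fun j => hll z j v hz
    have hr_inl : ∀ i, ∃ w, r i = .inl w := by
      intro i
      rcases hw : r i with w | w
      · exact ⟨w, rfl⟩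
      · obtain ⟨u, hu⟩ := hrr i z w hw
        simp [hc'] at hu
    choose r' hr' using hr_inl
    have h' : ∀ i j, r' i ≠ c' j ∧ g s(r' i, c' j) = false := by
      intro i j
      simpa [hr', hc', colourMatrix] using h i j
    exact hg false r' c' (fun i j e => hr (by rw [hr', hr', e]))
      (fun i j e => hc (by rw [hc', hc', e])) (fun i j => (h' i j).1) fun i j => (h' i j).2
  · choose c' hc' using fun j => hrr z j v hz
    have hr_inr : ∀ i, ∃ w, r i = .inr w := by
      intro i
      rcases hw : r i with w | w
      · obtain ⟨u, hu⟩ := hll i z w hw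
        simp [hc'] at hu
      · exact ⟨w, rfl⟩
    choose r' hr' using hr_inr
    have h' : ∀ i j, r' i ≠ c' j ∧ g s(r' i, c' j) = true := by
      intro i j
      simpa [hr', hc', colourMatrix] using h i j
    exact hg true r' c' (fun i j e => hr (by rw [hr', hr', e]))
      (fun i j e => hc (by rw [hc', hc', e])) (fun i j => (h' i j).1) fun i j => (h' i j).2

lemma colourMatrix_inl_and_inr {V : Type*} (g : Sym2 V → Bool) (i j : V) :
    colourMatrix g (.inl i) (.inl j) ∧ colourMatrix g (.inr i) (.inr j) ↔ i = j := by
  by_cases h : i = j <;> simp [colourMatrix, h]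

lemma two_mul_pow_lt_of_logb {h : ℕ} (hh : 2 ≤ h) {k : ℕ}
    (hk : k = 2 * ⌈2 * Real.logb 2 h⌉₊) : 2 * h ^ (2 * k) < 2 ^ (k * k) := by
  set m := ⌈2 * Real.logb 2 h⌉₊ with hm
  have hpos : (0 : ℝ) < h := by positivity
  have hlog : 2 * Real.logb 2 h ≤ m := Nat.le_ceil _
  have hsq : h ^ 2 ≤ 2 ^ m := by
    have : ((h : ℝ) ^ 2) ≤ (2 : ℝ) ^ (m : ℝ) := by
      rw [← Real.logb_le_iff_le_rpow (by norm_num) (by positivity), Real.logb_pow]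
      exact_mod_cast hlog
    rw [Real.rpow_natCast] at this
    exact_mod_cast this
  have hm1 : 1 ≤ m := by
    by_contra! h0
    have : m = 0 := by omega
    rw [this] at hsq
    nlinarith
  calc 2 * h ^ (2 * k) = 2 * (h ^ 2) ^ (2 * m) := by rw [← pow_mul, hk]
    _ ≤ 2 * (2 ^ m) ^ (2 * m) := by gcongr
    _ = 2 ^ (m * (2 * m) + 1) := by rw [← pow_mul, pow_succ']
    _ < 2 ^ (k * k) := by
      apply Nat.pow_lt_pow_right (by norm_num)
      rw [hk]
      nlinarith

theorem stmt10 : ∃ h₀ : ℕ, ∀ h : ℕ, h₀ ≤ h →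
    ∃ A : Fin (2 * h) → Fin (2 * h) → Prop,
      (∀ i j, A i j ↔ A j i) ∧
      ¬ HasZeroBlock A (2 * ⌈2 * Real.logb 2 h⌉₊) ∧
      h ≤ mim (kron A A) := by
  refine ⟨2, fun h hh => ?_⟩
  have hk := two_mul_pow_lt_of_logb hh rfl
  have hk0 : 0 < 2 * ⌈2 * Real.logb 2 h⌉₊ := by
    by_contra! h0
    simp [Nat.le_zero.1 h0] at hk
  obtain ⟨g, hg⟩ := exists_colouring_no_mono_biclique (V := Fin h)
    (2 * ⌈2 * Real.logb 2 h⌉₊) (by simpa only [Fintype.card_fin] using hk)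
  let e : Fin (2 * h) ≃ Fin h ⊕ Fin h := (finCongr (two_mul h)).trans finSumFinEquiv.symm
  refine ⟨fun i j => colourMatrix g (e i) (e j), fun i j => colourMatrix_symm g _ _, ?_, ?_⟩
  · rintro ⟨r, c, hr, hc, hz⟩
    exact not_hasZeroBlock_colourMatrix g hk0 hg
      ⟨e ∘ r, e ∘ c, e.injective.comp hr, e.injective.comp hc, hz⟩
  · have hinj : Function.Injective fun i : Fin h => (e.symm (.inl i), e.symm (.inr i)) :=
      fun i j hij => Sum.inl_injective (e.symm.injective (Prod.ext_iff.1 hij).1)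
    refine HasMim.le_mim ⟨_, _, hinj, hinj, fun i j => ?_⟩
    simpa [kron] using colourMatrix_inl_and_inr g i j
end
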